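/- arXiv:2405.06235 — 2 statements merged into one kernel-verified Lean document; each statement's English description precedes it below -/
import Mathlib

section
/- Let δ0 > 0, δ > 0, λ > 0 and define φ(x) = ((δ0 + 2δ)·x² + (1+λ)·δ0·δ·x) / (2x² + ((1+2λ)·δ0 + 2λ·δ)·x + λ·(1+λ)·δ0·δ). Then φ is twice differentiable on (0, ∞) and its second derivative satisfies φ''(x) < 0 for every x > 0; in particular φ is strictly concave on (0, ∞). -/
/-- The reinsurer's best-response function with insurer risk aversion `δ0`,
reinsurer risk aversion `δ`, and competitor's competition degree `lam`. -/
noncomputable def phi (δ0 δ lam x : ℝ) : ℝ :=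
  ((δ0 + 2 * δ) * x^2 + (1 + lam) * δ0 * δ * x) /
    (2 * x^2 + ((1 + 2 * lam) * δ0 + 2 * lam * δ) * x + lam * (1 + lam) * δ0 * δ)

section QuadraticQuotient

variable {a b c e f x : ℝ}

theorem hasDerivAt_quadratic (a b c x : ℝ) :
    HasDerivAt (fun y : ℝ => a * y ^ 2 + b * y + c) (2 * a * x + b) x := by
  have h := ((((hasDerivAt_id' x).pow 2).const_mul a).add
    ((hasDerivAt_id' x).const_mul b)).add_const c
  refine h.congr_deriv ?_
  norm_num
  ring

theorem hasDerivAt_quadratic_div (hD : c * x ^ 2 + e * x + f ≠ 0) :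
    HasDerivAt (fun y : ℝ => (a * y ^ 2 + b * y) / (c * y ^ 2 + e * y + f))
      (((a * e - b * c) * x ^ 2 + 2 * (a * f) * x + b * f) / (c * x ^ 2 + e * x + f) ^ 2) x := by
  have hN : HasDerivAt (fun y : ℝ => a * y ^ 2 + b * y) (2 * a * x + b) x := by
    simpa using hasDerivAt_quadratic a b 0 x
  refine (hN.div (hasDerivAt_quadratic c e f x) hD).congr_deriv ?_
  congr 1
  ring

theorem hasDerivAt_deriv_quadratic_div (hD : c * x ^ 2 + e * x + f ≠ 0) :
    HasDerivAt (fun y : ℝ => ((a * e - b * c) * y ^ 2 + 2 * (a * f) * y + b * f) /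
        (c * y ^ 2 + e * y + f) ^ 2)
      (-2 * ((a * e - b * c) * c * x ^ 3 + 3 * (a * f * c) * x ^ 2 + 3 * (b * c * f) * x
        + f * (b * e - a * f)) / (c * x ^ 2 + e * x + f) ^ 3) x := by
  refine ((hasDerivAt_quadratic (a * e - b * c) (2 * (a * f)) (b * f) x).div
    ((hasDerivAt_quadratic c e f x).pow 2) (pow_ne_zero 2 hD)).congr_deriv ?_
  simp only [Pi.pow_apply]
  rw [div_eq_div_iff (pow_ne_zero 2 (pow_ne_zero 2 hD)) (pow_ne_zero 3 hD)]
  push_cast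
  ring

end QuadraticQuotient

theorem stmt_4 (δ0 δ lam : ℝ) (hδ0 : 0 < δ0) (hδ : 0 < δ) (hlam : 0 < lam) :
    (∀ x : ℝ, 0 < x →
      DifferentiableAt ℝ (phi δ0 δ lam) x ∧
      DifferentiableAt ℝ (deriv (phi δ0 δ lam)) x ∧
      deriv (deriv (phi δ0 δ lam)) x < 0) ∧
    StrictConcaveOn ℝ (Set.Ioi 0) (phi δ0 δ lam) := by
  obtain ⟨a, ha⟩ : ∃ a, a = δ0 + 2 * δ := ⟨_, rfl⟩
  obtain ⟨b, hb⟩ : ∃ b, b = (1 + lam) * δ0 * δ := ⟨_, rfl⟩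
  obtain ⟨e, he⟩ : ∃ e, e = (1 + 2 * lam) * δ0 + 2 * lam * δ := ⟨_, rfl⟩
  obtain ⟨f, hf⟩ : ∃ f, f = lam * (1 + lam) * δ0 * δ := ⟨_, rfl⟩
  have ha0 : 0 < a := by rw [ha]; positivity
  have hb0 : 0 < b := by rw [hb]; positivity
  have he0 : 0 < e := by rw [he]; positivity
  have hf0 : 0 < f := by rw [hf]; positivity
  have hA : 0 < a * e - b * 2 := by
    have : a * e - b * 2 = (1 + 2 * lam) * δ0 ^ 2 + 4 * lam * δ0 * δ + 4 * lam * δ ^ 2 := by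
      rw [ha, hb, he]; ring
    rw [this]; positivity
  have hC : 0 < b * e - a * f := by
    have : b * e - a * f = (1 + lam) ^ 2 * δ0 ^ 2 * δ := by
      rw [ha, hb, he, hf]; ring
    rw [this]; positivity
  have hphi : phi δ0 δ lam = fun y => (a * y ^ 2 + b * y) / (2 * y ^ 2 + e * y + f) := by
    subst ha hb he hf
    rfl
  rw [hphi]
  have hD : ∀ x : ℝ, 0 < x → 0 < 2 * x ^ 2 + e * x + f := fun x hx => by positivity
  have hd : ∀ x : ℝ, 0 < x → _ := fun x hx =>
    hasDerivAt_quadratic_div (a := a) (b := b) (hD x hx).ne'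
  have hd2 : ∀ x : ℝ, 0 < x → _ := fun x hx =>
    (hasDerivAt_deriv_quadratic_div (a := a) (b := b) (hD x hx).ne').congr_of_eventuallyEq
      ((eventually_gt_nhds hx).mono fun y hy => (hd y hy).deriv)
  have hneg : ∀ x : ℝ, 0 < x →
      deriv (deriv fun y => (a * y ^ 2 + b * y) / (2 * y ^ 2 + e * y + f)) x < 0 := by
    intro x hx
    rw [(hd2 x hx).deriv]
    refine div_neg_of_neg_of_pos ?_ (pow_pos (hD x hx) 3)
    refine mul_neg_of_neg_of_pos (by norm_num) ?_
    positivity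
  refine ⟨fun x hx => ⟨(hd x hx).differentiableAt, (hd2 x hx).differentiableAt, hneg x hx⟩, ?_⟩
  refine strictConcaveOn_of_deriv2_neg (convex_Ioi 0)
    (fun x hx => (hd x hx).continuousAt.continuousWithinAt) fun x hx => ?_
  rw [interior_Ioi] at hx
  exact hneg x hx
end

section
/- Let δ1, δ2 > 0, λ1, λ2 > 0 with λ1·λ2 < 1, and let 0 < δ0 < δ0'. Let (θ1, θ2) ∈ (0,∞)² be the unique equilibrium premium pair for the parameters (δ0, δ1, δ2, λ1, λ2), and let (θ1', θ2') ∈ (0,∞)² be the unique equilibrium premium pair for the parameters (δ0', δ1, δ2, λ1, λ2). Then θ1 < θ1' and θ2 < θ2'; that is, both reinsurers' equilibrium premium loadings are strictly increasing in the insurer's risk aversion δ0. -/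
theorem phi_denom_pos {a d l x : ℝ} (ha : 0 < a) (hd : 0 < d) (hl : 0 < l) (hx : 0 < x) :
    0 < 2 * x^2 + ((1 + 2 * l) * a + 2 * l * d) * x + l * (1 + l) * a * d := by
  positivity

/-- The best response is strictly increasing in the insurer's risk aversion. -/
theorem phi_lt_phi_of_riskAversion_lt {a b d l x : ℝ} (ha : 0 < a) (hab : a < b) (hd : 0 < d)
    (hl : 0 < l) (hx : 0 < x) : phi a d l x < phi b d l x := by
  unfold phi
  rw [div_lt_div_iff₀ (phi_denom_pos ha hd hl hx) (phi_denom_pos (ha.trans hab) hd hl hx)]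
  have h : 0 < (b - a) * (2 * x ^ 4) := mul_pos (sub_pos.2 hab) (by positivity)
  linear_combination h

/-- The best response is increasing in the competitor's premium. -/
theorem phi_le_phi_of_le {a d l x y : ℝ} (ha : 0 < a) (hd : 0 < d) (hl : 0 < l) (hx : 0 < x)
    (hxy : x ≤ y) : phi a d l x ≤ phi a d l y := by
  have hy : 0 < y := hx.trans_le hxy
  unfold phi
  rw [div_le_div_iff₀ (phi_denom_pos ha hd hl hx) (phi_denom_pos ha hd hl hy)]
  have h : 0 ≤ (y - x) * (((1 + 2 * l) * a ^ 2 + 4 * l * a * d + 4 * l * d ^ 2) * (x * y)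
      + (a + 2 * d) * (l * (1 + l) * a * d) * (x + y)
      + (1 + l) * a * d * (l * (1 + l) * a * d)) :=
    mul_nonneg (sub_nonneg.2 hxy) (by positivity)
  linear_combination h

/-- The best response is subhomogeneous in the competitor's premium. -/
theorem mul_phi_le_phi_mul {a d l x t : ℝ} (ha : 0 < a) (hd : 0 < d) (hl : 0 < l) (hx : 0 < x)
    (ht : 0 < t) (ht1 : t ≤ 1) : t * phi a d l x ≤ phi a d l (t * x) := by
  unfold phi
  rw [← mul_div_assoc,
    div_le_div_iff₀ (phi_denom_pos ha hd hl hx) (phi_denom_pos ha hd hl (mul_pos ht hx))]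
  have h : 0 ≤ (1 - t) * (t * x * (2 * (a + 2 * d) * t * x ^ 3
      + 2 * ((1 + l) * a * d) * (1 + t) * x ^ 2 + (1 + l) ^ 2 * a ^ 2 * d * x)) :=
    mul_nonneg (sub_nonneg.2 ht1) (by positivity)
  linear_combination h

/-- If raising the insurer's risk aversion scales the competitor's premium by at least the factor
by which it scales the best response, then that response strictly increases. -/
theorem lt_of_eq_phi_of_div_le_div {a b d l x x' y y' : ℝ} (ha : 0 < a) (hab : a < b)
    (hd : 0 < d) (hl : 0 < l) (hx : 0 < x) (hx' : 0 < x') (hy : 0 < y) (hy' : 0 < y')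
    (h : y = phi a d l x) (h' : y' = phi b d l x') (hr : y' / y ≤ x' / x) : y < y' := by
  by_contra! hle
  have ht : 0 < y' / y := div_pos hy' hy
  have hlt : y' / y * y < y' := calc
    y' / y * y = y' / y * phi a d l x := by rw [← h]
    _ ≤ phi a d l (y' / y * x) := mul_phi_le_phi_mul ha hd hl hx ht ((div_le_one hy).2 hle)
    _ ≤ phi a d l x' := phi_le_phi_of_le ha hd hl (mul_pos ht hx) ((le_div_iff₀ hx).1 hr)
    _ < phi b d l x' := phi_lt_phi_of_riskAversion_lt ha hab hd hl hx'
    _ = y' := h'.symm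
  rw [div_mul_cancel₀ _ hy.ne'] at hlt
  exact hlt.false

theorem stmt_12 (δ1 δ2 lam1 lam2 : ℝ) (hδ1 : 0 < δ1) (hδ2 : 0 < δ2)
    (hlam1 : 0 < lam1) (hlam2 : 0 < lam2) (hprod : lam1 * lam2 < 1)
    (δ0 δ0' : ℝ) (hδ0 : 0 < δ0) (hδ0' : δ0 < δ0')
    (θ1 θ2 θ1' θ2' : ℝ) (hθ1 : 0 < θ1) (hθ2 : 0 < θ2) (hθ1' : 0 < θ1') (hθ2' : 0 < θ2')
    (hfix1 : θ1 = phi δ0 δ1 lam2 θ2) (hfix2 : θ2 = phi δ0 δ2 lam1 θ1)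
    (hfix1' : θ1' = phi δ0' δ1 lam2 θ2') (hfix2' : θ2' = phi δ0' δ2 lam1 θ1') :
    θ1 < θ1' ∧ θ2 < θ2' := by
  rcases le_total (θ1' / θ1) (θ2' / θ2) with hr | hr
  · have h := lt_of_eq_phi_of_div_le_div hδ0 hδ0' hδ1 hlam2 hθ2 hθ2' hθ1 hθ1' hfix1 hfix1' hr
    exact ⟨h, (one_lt_div hθ2).1 (((one_lt_div hθ1).2 h).trans_le hr)⟩
  · have h := lt_of_eq_phi_of_div_le_div hδ0 hδ0' hδ2 hlam1 hθ1 hθ1' hθ2 hθ2' hfix2 hfix2' hr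
    exact ⟨(one_lt_div hθ1).1 (((one_lt_div hθ2).2 h).trans_le hr), h⟩
end
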